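/- Let ω be a snake trajectory with initial point 0 and let b < 0 be such that the Lebesgue measure of {s ∈ [0, σ(ω)] : τ_b(ω_s) = ζ_s(ω)} is zero. Then for any sequence (b_n) with b < b_n < 0 and b_n ↓ b as n → ∞, one has tr_{b_n}(ω) → tr_b(ω) in (S, d_S) as n → ∞. -/

import Mathlib

open MeasureTheory

/-- A finite path: a continuous real function defined on the time interval
`[0, lifetime]`, encoded as a function on all of `ℝ` which is constant on
`(-∞, 0]` and on `[lifetime, ∞)` (stopped extension). -/
structure FinPath where
  /-- the lifetime `ζ_(w)` of the path -/
  lifetime : ℝ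
  lifetime_nonneg : 0 ≤ lifetime
  /-- the path itself (extended by stopping outside `[0, lifetime]`) -/
  toFun : ℝ → ℝ
  cont : Continuous toFun
  stopped : ∀ t : ℝ, toFun t = toFun (min (max t 0) lifetime)

namespace FinPath

/-- the endpoint (tip) `ŵ = w(ζ_(w))` of a finite path -/
def tip (w : FinPath) : ℝ := w.toFun w.lifetime

/-- the trivial path at `x`, with zero lifetime; it is identified with the point `x` -/
def triv (x : ℝ) : FinPath :=
  ⟨0, le_refl 0, fun _ => x, continuous_const, fun _ => rfl⟩

/-- the distance `d_W` on finite paths: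
`d_W(w,w') = |ζ_(w) - ζ_(w')| + sup_t |w(t∧ζ_(w)) - w'(t∧ζ_(w'))|`. -/
noncomputable def dW (w w' : FinPath) : ℝ :=
  |w.lifetime - w'.lifetime| + ⨆ t : ℝ, |w.toFun t - w'.toFun t|

/-- the first hitting time `τ*_y(w) = inf {t ∈ (0, ζ_(w)] : w(t) = y}` of `y`,
an extended real number (`⊤ = +∞` if the path does not hit `y` on `(0, ζ_(w)]`). -/
noncomputable def tauStar (y : ℝ) (w : FinPath) : EReal :=
  sInf ((fun t : ℝ => (t : EReal)) '' {t : ℝ | 0 < t ∧ t ≤ w.lifetime ∧ w.toFun t = y})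

/-- the first hitting time `τ_y(w) = inf {t ∈ [0, ζ_(w)] : w(t) = y}` of `y`,
an extended real number (`⊤ = +∞` if the path does not hit `y`). -/
noncomputable def tau (y : ℝ) (w : FinPath) : EReal :=
  sInf ((fun t : ℝ => (t : EReal)) '' {t : ℝ | 0 ≤ t ∧ t ≤ w.lifetime ∧ w.toFun t = y})

end FinPath

/-- `ω` is a snake trajectory with initial point `x`: the time parameter runs over
`[0,∞)` (the map is extended trivially to negative times), `ω_0 = x`, every path `ω_s`
starts at `x`, `ω` is continuous for `d_W`, `σ(ω) = sup {s : ω_s ≠ x} < ∞`, and the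
snake property holds. -/
structure IsSnakeTraj (x : ℝ) (ω : ℝ → FinPath) : Prop where
  init : ∀ s : ℝ, s ≤ 0 → ω s = FinPath.triv x
  start : ∀ s : ℝ, (ω s).toFun 0 = x
  cont : ∀ s : ℝ, ∀ ε > (0:ℝ), ∃ δ > (0:ℝ), ∀ s' : ℝ,
    |s' - s| < δ → FinPath.dW (ω s') (ω s) < ε
  finite : BddAbove {s : ℝ | ω s ≠ FinPath.triv x}
  snake : ∀ s s' : ℝ, 0 ≤ s → s ≤ s' → ∀ t : ℝ, 0 ≤ t →
    t ≤ sInf ((fun r => (ω r).lifetime) '' Set.Icc s s') →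
    (ω s).toFun t = (ω s').toFun t

/-- the duration `σ(ω) = sup {s ≥ 0 : ω_s ≠ ω_0}` of a trajectory
(with the convention `sup ∅ = 0`, which is `Real.sSup`'s convention). -/
noncomputable def sigmaTraj (ω : ℝ → FinPath) : ℝ := sSup {s : ℝ | ω s ≠ ω 0}

/-- the distance `d_S(ω,ω') = |σ(ω) - σ(ω')| + sup_s d_W(ω_s, ω'_s)`
on snake trajectories. -/
noncomputable def dS (ω ω' : ℝ → FinPath) : ℝ :=
  |sigmaTraj ω - sigmaTraj ω'| + ⨆ s : ℝ, FinPath.dW (ω s) (ω' s)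

/-- `(h, f)` is a tree-like path: `h ≥ 0` and `f` are continuous, vanish
(resp. are constant) on `(-∞,0]` (time runs over `[0,∞)`),
`σ_h = sup {s : h s ≠ 0} < ∞`, and whenever `h(s) = h(s') = min_{[s,s']} h`
one has `f(s) = f(s')`. -/
structure IsTreeLike (h f : ℝ → ℝ) : Prop where
  cont_h : Continuous h
  cont_f : Continuous f
  nonneg : ∀ s, 0 ≤ h s
  h_nonpos : ∀ s : ℝ, s ≤ 0 → h s = 0
  f_nonpos : ∀ s : ℝ, s ≤ 0 → f s = f 0
  finite : BddAbove {s : ℝ | h s ≠ 0}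
  treeLike : ∀ s s' : ℝ, 0 ≤ s → s ≤ s' → h s = h s' →
    h s = sInf (h '' Set.Icc s s') → f s = f s'

/-- `σ_h = sup {s : h s ≠ 0}` (with `sup ∅ = 0`). -/
noncomputable def sigmaH (h : ℝ → ℝ) : ℝ := sSup {s : ℝ | h s ≠ 0}

/-- the distance on tree-like paths:
`d_T((h,f),(h',f')) = |σ_h - σ_{h'}| + sup_s (|h s - h' s| + |f s - f' s|)`. -/
noncomputable def dT (h f h' f' : ℝ → ℝ) : ℝ :=
  |sigmaH h - sigmaH h'| + ⨆ s : ℝ, (|h s - h' s| + |f s - f' s|)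

section Trunc

/-- `A_s = ∫_0^s 1{ζ_r(ω) ≤ τ*_y(ω_r)} dr`. -/
noncomputable def truncA (y : ℝ) (ω : ℝ → FinPath) (s : ℝ) : ℝ :=
  ∫ r in (0:ℝ)..s,
    Set.indicator {r : ℝ | ((ω r).lifetime : EReal) ≤ FinPath.tauStar y (ω r)}
      (fun _ => (1:ℝ)) r

/-- `η_s = inf {r ≥ 0 : A_r > s}`. -/
noncomputable def truncEta (y : ℝ) (ω : ℝ → FinPath) (s : ℝ) : ℝ :=
  sInf {r : ℝ | truncA y ω r > s}

/-- the truncation `tr_y(ω)` of `ω` at `y`, defined by `tr_y(ω)_s = ω_{η_s}`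
for `s ≥ 0` (and extended to negative times by the value at `0`). -/
noncomputable def trunc (y : ℝ) (ω : ℝ → FinPath) : ℝ → FinPath :=
  fun s => ω (truncEta y ω (max s 0))

end Trunc

section Sub

private lemma stop_aux (g : ℝ → ℝ) (c L : ℝ) (hL : 0 ≤ L) (t : ℝ) :
    g (c + min (max t 0) L) = g (c + min (max (min (max t 0) L) 0) L) := by
  have h0u : 0 ≤ min (max t 0) L := le_min (le_max_right t 0) hL
  rw [max_eq_left h0u, min_eq_left (min_le_right _ _)]

/-- the time index `(a + s) ∧ b` (with `s` clamped to `[0,∞)`). -/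
def subIdx (a b s : ℝ) : ℝ := min (a + max s 0) b

/-- The subtrajectory of `ω` associated with the interval `[a,b]`:
`(subPath ω a b)_s (t) = ω_{(a+s)∧b} (ζ_a + t)` for `0 ≤ t ≤ ζ_{(a+s)∧b} - ζ_a`.
(The lifetime is clamped at `0` to make the definition total; when
`ζ_a = ζ_b = min_{[a,b]} ζ` this is the usual subtrajectory.) -/
noncomputable def subPath (ω : ℝ → FinPath) (a b : ℝ) (s : ℝ) : FinPath where
  lifetime := max 0 ((ω (subIdx a b s)).lifetime - (ω a).lifetime)
  lifetime_nonneg := le_max_left _ _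
  toFun := fun t => (ω (subIdx a b s)).toFun ((ω a).lifetime +
    min (max t 0) (max 0 ((ω (subIdx a b s)).lifetime - (ω a).lifetime)))
  cont := by
    exact (ω (subIdx a b s)).cont.comp
      (continuous_const.add ((continuous_id.max continuous_const).min continuous_const))
  stopped := fun t => stop_aux _ _ _ (le_max_left 0 _) t

end Sub

open Set Filter Topology

namespace FinPath

theorem ext' {w w' : FinPath} (h : w.lifetime = w'.lifetime)
    (h' : ∀ t, 0 ≤ t → t ≤ w.lifetime → w.toFun t = w'.toFun t) : w = w' := by
  have hf : w.toFun = w'.toFun := by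
    funext t
    rw [w.stopped t, w'.stopped t, ← h]
    exact h' _ (le_min (le_max_right _ _) w.lifetime_nonneg) (min_le_right _ _)
  cases w
  cases w'
  simp_all

theorem exists_bound (w : FinPath) : ∃ C, ∀ t, |w.toFun t| ≤ C := by
  obtain ⟨C, hC⟩ := (isCompact_Icc (a := (0 : ℝ)) (b := w.lifetime)).exists_bound_of_continuousOn
    w.cont.continuousOn
  refine ⟨C, fun t => ?_⟩
  rw [w.stopped t]
  exact hC _ ⟨le_min (le_max_right _ _) w.lifetime_nonneg, min_le_right _ _⟩

theorem bddAbove_abs_sub (w w' : FinPath) :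
    BddAbove (range fun t : ℝ => |w.toFun t - w'.toFun t|) := by
  obtain ⟨C, hC⟩ := w.exists_bound
  obtain ⟨C', hC'⟩ := w'.exists_bound
  refine ⟨C + C', ?_⟩
  rintro _ ⟨t, rfl⟩
  exact (abs_sub _ _).trans (add_le_add (hC t) (hC' t))

theorem iSup_abs_sub_nonneg (w w' : FinPath) : 0 ≤ ⨆ t : ℝ, |w.toFun t - w'.toFun t| :=
  Real.iSup_nonneg fun _ => abs_nonneg _

theorem abs_lifetime_sub_le (w w' : FinPath) : |w.lifetime - w'.lifetime| ≤ dW w w' :=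
  le_add_of_nonneg_right (iSup_abs_sub_nonneg w w')

theorem abs_toFun_sub_le (w w' : FinPath) (t : ℝ) : |w.toFun t - w'.toFun t| ≤ dW w w' :=
  (le_ciSup (bddAbove_abs_sub w w') t).trans (le_add_of_nonneg_left (abs_nonneg _))

/-- The pseudometric structure given by `d_W`. -/
noncomputable abbrev pseudoMetric : PseudoMetricSpace FinPath where
  dist := dW
  dist_self w := by simp [dW]
  dist_comm w w' := by simp only [dW, abs_sub_comm]
  dist_triangle w₁ w₂ w₃ := by
    have h : (⨆ t : ℝ, |w₁.toFun t - w₃.toFun t|) ≤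
        (⨆ t : ℝ, |w₁.toFun t - w₂.toFun t|) + ⨆ t : ℝ, |w₂.toFun t - w₃.toFun t| :=
      ciSup_le fun t => (abs_sub_le _ (w₂.toFun t) _).trans
        (add_le_add (le_ciSup (bddAbove_abs_sub w₁ w₂) t) (le_ciSup (bddAbove_abs_sub w₂ w₃) t))
    have h' := abs_sub_le w₁.lifetime w₂.lifetime w₃.lifetime
    simp only [dW]
    linarith

attribute [local instance] pseudoMetric

theorem dW_nonneg (w w' : FinPath) : 0 ≤ dW w w' :=
  dist_nonneg (x := w) (y := w')

theorem continuous_lifetime : Continuous lifetime :=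
  continuous_iff_continuousAt.2 fun w => Metric.continuousAt_iff.2 fun ε hε =>
    ⟨ε, hε, fun {w'} h => (abs_lifetime_sub_le w' w).trans_lt h⟩

theorem lifetime_le_tauStar_iff (y : ℝ) (w : FinPath) :
    (w.lifetime : EReal) ≤ tauStar y w ↔ ∀ t, 0 < t → t < w.lifetime → w.toFun t ≠ y := by
  rw [tauStar, le_sInf_iff]
  constructor
  · intro h t ht htl hty
    have := h _ ⟨t, ⟨ht, htl.le, hty⟩, rfl⟩
    exact absurd (EReal.coe_le_coe_iff.1 this) (not_le.2 htl)
  · rintro h _ ⟨t, ⟨ht, -, hty⟩, rfl⟩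
    refine EReal.coe_le_coe_iff.2 ?_
    by_contra! hlt
    exact h t ht hlt hty

theorem exists_hit {w : FinPath} (h0 : w.toFun 0 = 0) {x y : ℝ} (hx : 0 ≤ x) (hy : y < 0)
    (hxy : w.toFun x ≤ y) : ∃ t, 0 < t ∧ t ≤ x ∧ w.toFun t = y := by
  obtain ⟨t, ht, hty⟩ := intermediate_value_Icc' hx w.cont.continuousOn
    (show y ∈ Icc (w.toFun x) (w.toFun 0) from ⟨hxy, hy.le.trans_eq h0.symm⟩)
  refine ⟨t, ht.1.lt_of_ne ?_, ht.2, hty⟩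
  rintro rfl
  exact hy.ne (hty.symm.trans h0)

theorem exists_margin {w : FinPath} (h0 : w.toFun 0 = 0) {y : ℝ} (hy : y < 0)
    (h : ∀ t, 0 < t → t ≤ w.lifetime → w.toFun t ≠ y) : ∃ c > y, ∀ t, c ≤ w.toFun t := by
  obtain ⟨x, hx, hmin⟩ := (isCompact_Icc (a := (0 : ℝ)) (b := w.lifetime)).exists_isMinOn
    ⟨0, left_mem_Icc.2 w.lifetime_nonneg⟩ w.cont.continuousOn
  refine ⟨w.toFun x, ?_, fun t => ?_⟩
  · by_contra! hle
    obtain ⟨t, ht, htx, hty⟩ := exists_hit h0 hx.1 hy hle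
    exact h t ht (htx.trans hx.2) hty
  · rw [w.stopped t]
    exact hmin ⟨le_min (le_max_right _ _) w.lifetime_nonneg, min_le_right _ _⟩

end FinPath

attribute [local instance] FinPath.pseudoMetric

/-- The times at which the path has not hit `y` strictly before its lifetime. -/
def keepSet (y : ℝ) (ω : ℝ → FinPath) : Set ℝ :=
  {r : ℝ | ((ω r).lifetime : EReal) ≤ FinPath.tauStar y (ω r)}

theorem mem_keepSet_iff {y : ℝ} {ω : ℝ → FinPath} {r : ℝ} :
    r ∈ keepSet y ω ↔ ∀ t, 0 < t → t < (ω r).lifetime → (ω r).toFun t ≠ y :=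
  FinPath.lifetime_le_tauStar_iff y (ω r)

theorem csInf_superlevel {f : ℝ → ℝ} (hf : Continuous f) {s : ℝ} (hne : {r | f r > s}.Nonempty)
    (hbdd : BddBelow {r | f r > s}) : f (sInf {r | f r > s}) = s := by
  apply le_antisymm
  · by_contra! h
    obtain ⟨l, hl, hsub⟩ := exists_Ioc_subset_of_mem_nhds
      ((isOpen_lt continuous_const hf).mem_nhds h) (exists_lt _)
    obtain ⟨m, hlm, hm⟩ := exists_between hl
    exact absurd (csInf_le hbdd (hsub ⟨hlm, hm.le⟩)) (not_le.2 hm)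
  · have := csInf_mem_closure hne hbdd
    exact closure_minimal (fun r hr => le_of_lt hr) (isClosed_le continuous_const hf) this

namespace IsSnakeTraj

variable {ω : ℝ → FinPath}

theorem continuous (hω : IsSnakeTraj 0 ω) : Continuous ω :=
  Metric.continuous_iff.2 fun s ε hε => hω.cont s ε hε

theorem apply_zero (hω : IsSnakeTraj 0 ω) : ω 0 = FinPath.triv 0 := hω.init 0 le_rfl

theorem snake_uIcc (hω : IsSnakeTraj 0 ω) (u v t : ℝ) (ht : 0 ≤ t)
    (h : ∀ r ∈ uIcc u v, t ≤ (ω r).lifetime) : (ω u).toFun t = (ω v).toFun t := by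
  wlog huv : u ≤ v generalizing u v
  · exact (this v u (by rwa [uIcc_comm]) (le_of_not_ge huv)).symm
  rw [uIcc_of_le huv] at h
  rcases lt_or_ge u 0 with hu | hu
  · have h0 := h u (left_mem_Icc.2 huv)
    rw [hω.init u hu.le] at h0
    obtain rfl : t = 0 := le_antisymm h0 ht
    rw [hω.start, hω.start]
  · refine hω.snake u v hu huv t ht (le_csInf ((nonempty_Icc.2 huv).image _) ?_)
    rintro _ ⟨r, hr, rfl⟩
    exact h r hr

theorem mem_keepSet_of_eq_triv {y r : ℝ} (h : ω r = FinPath.triv 0) : r ∈ keepSet y ω := by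
  rw [mem_keepSet_iff, h]
  exact fun t ht ht' => absurd ht' (not_lt.2 ht.le)

theorem isClosed_keepSet (hω : IsSnakeTraj 0 ω) (y : ℝ) : IsClosed (keepSet y ω) := by
  rw [← isOpen_compl_iff, Metric.isOpen_iff]
  intro r hr
  rw [mem_compl_iff, mem_keepSet_iff] at hr
  push Not at hr
  obtain ⟨t, ht, htl, hty⟩ := hr
  obtain ⟨δ, hδ, hball⟩ := Metric.isOpen_iff.1
    (isOpen_lt continuous_const (FinPath.continuous_lifetime.comp hω.continuous)) r htl
  refine ⟨δ, hδ, fun r' hr' => ?_⟩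
  rw [mem_compl_iff, mem_keepSet_iff]
  push Not
  refine ⟨t, ht, hball hr', ?_⟩
  rw [← hty]
  refine (hω.snake_uIcc r r' t ht.le fun q hq => le_of_lt (hball ?_)).symm
  rw [Real.ball_eq_Ioo] at hr' ⊢
  exact ordConnected_Ioo.uIcc_subset ⟨by linarith, by linarith⟩ hr' hq

theorem isClosed_hit (hω : IsSnakeTraj 0 ω) {y : ℝ} (hy : y < 0) :
    IsClosed {r | ∃ t, 0 < t ∧ t ≤ (ω r).lifetime ∧ (ω r).toFun t = y} := by
  rw [← isOpen_compl_iff, Metric.isOpen_iff]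
  intro r hr
  simp only [mem_compl_iff, mem_ofPred_eq] at hr
  push Not at hr
  obtain ⟨c, hc, hle⟩ := FinPath.exists_margin (hω.start r) hy hr
  obtain ⟨δ, hδ, hball⟩ := hω.cont r (c - y) (by linarith)
  refine ⟨δ, hδ, ?_⟩
  rintro r' hr' ⟨t, -, -, hty⟩
  have h1 := (FinPath.abs_toFun_sub_le (ω r') (ω r) t).trans_lt (hball r' hr')
  have h2 := hle t
  rw [hty, abs_lt] at h1
  linarith [h1.1]

theorem eq_of_volume_eq_zero (hω : IsSnakeTraj 0 ω) {y : ℝ} (hy : y < 0) {u v : ℝ}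
    (hu : u ∈ keepSet y ω) (hv : v ∈ keepSet y ω) (huv : u ≤ v)
    (h : volume (keepSet y ω ∩ Ioc u v) = 0) : ω u = ω v := by
  rcases huv.eq_or_lt with rfl | hlt
  · rfl
  have hhit : ∀ r ∈ Icc u v, ∃ t, 0 < t ∧ t ≤ (ω r).lifetime ∧ (ω r).toFun t = y := by
    rw [← closure_Ioo hlt.ne]
    have hdense : closure (Ioo u v) ⊆ closure (Ioo u v \ keepSet y ω) := by
      refine closure_minimal (fun r hr => ?_) isClosed_closure
      rw [mem_closure_iff]
      intro o ho hro
      by_contra hemp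
      have hsub : o ∩ Ioo u v ⊆ keepSet y ω ∩ Ioc u v := by
        rintro q ⟨hqo, hq⟩
        refine ⟨?_, Ioo_subset_Ioc_self hq⟩
        by_contra hqk
        exact hemp ⟨q, hqo, hq, hqk⟩
      exact ((ho.inter isOpen_Ioo).measure_pos volume ⟨r, hro, hr⟩).ne'
        (measure_mono_null hsub h)
    refine hdense.trans (closure_minimal ?_ (hω.isClosed_hit hy))
    rintro r ⟨-, hr⟩
    rw [mem_keepSet_iff] at hr
    push Not at hr
    obtain ⟨t, ht, htl, hty⟩ := hr
    exact ⟨t, ht, htl.le, hty⟩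
  obtain ⟨p, hp, hmin⟩ := (isCompact_Icc (a := u) (b := v)).exists_isMinOn
    ⟨u, left_mem_Icc.2 huv⟩ (FinPath.continuous_lifetime.comp hω.continuous).continuousOn
  have hmin' : ∀ r ∈ Icc u v, (ω p).lifetime ≤ (ω r).lifetime := fun r hr => hmin hr
  obtain ⟨t, ht, htp, hty⟩ := hhit p hp
  have key : ∀ r ∈ Icc u v, r ∈ keepSet y ω → (ω r).lifetime = (ω p).lifetime := by
    intro r hr hrk
    refine le_antisymm ?_ (hmin' r hr)
    by_contra! hlt'
    refine mem_keepSet_iff.1 hrk t ht (htp.trans_lt hlt') ?_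
    rw [← hty]
    exact hω.snake_uIcc r p t ht.le fun q hq =>
      htp.trans (hmin' q (ordConnected_Icc.uIcc_subset hr hp hq))
  have hul := key u (left_mem_Icc.2 huv) hu
  refine FinPath.ext' (hul.trans (key v (right_mem_Icc.2 huv) hv).symm) fun t ht htl => ?_
  refine hω.snake_uIcc u v t ht fun q hq => (htl.trans hul.le).trans (hmin' q ?_)
  rwa [uIcc_of_le huv] at hq

theorem intervalIntegrable_indicator (hω : IsSnakeTraj 0 ω) (y u v : ℝ) :
    IntervalIntegrable ((keepSet y ω).indicator fun _ => (1 : ℝ)) volume u v := by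
  rw [intervalIntegrable_iff]
  exact (integrableOn_const (by simp)).indicator (hω.isClosed_keepSet y).measurableSet

theorem truncA_zero (y : ℝ) : truncA y ω 0 = 0 := intervalIntegral.integral_same

theorem truncA_sub (hω : IsSnakeTraj 0 ω) (y : ℝ) {u v : ℝ} (huv : u ≤ v) :
    truncA y ω v - truncA y ω u = volume.real (keepSet y ω ∩ Ioc u v) := by
  have h := intervalIntegral.integral_interval_sub_left
    (hω.intervalIntegrable_indicator y 0 v) (hω.intervalIntegrable_indicator y 0 u)
  have h' : truncA y ω v - truncA y ω u =
    ∫ r in u..v, (keepSet y ω).indicator (fun _ => (1 : ℝ)) r := h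
  rw [h', intervalIntegral.integral_of_le huv,
    integral_indicator_const _ (hω.isClosed_keepSet y).measurableSet, measureReal_def,
    Measure.restrict_apply (hω.isClosed_keepSet y).measurableSet]
  simp [measureReal_def]

theorem continuous_truncA (hω : IsSnakeTraj 0 ω) (y : ℝ) : Continuous (truncA y ω) :=
  intervalIntegral.continuous_primitive (fun u v => hω.intervalIntegrable_indicator y u v) 0

theorem monotone_truncA (hω : IsSnakeTraj 0 ω) (y : ℝ) : Monotone (truncA y ω) := by
  intro u v huv
  have := hω.truncA_sub y huv
  linarith [measureReal_nonneg (μ := volume) (s := keepSet y ω ∩ Ioc u v)]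

theorem eq_of_truncA_eq (hω : IsSnakeTraj 0 ω) {y : ℝ} (hy : y < 0) {u v : ℝ}
    (hu : u ∈ keepSet y ω) (hv : v ∈ keepSet y ω) (h : truncA y ω u = truncA y ω v) :
    ω u = ω v := by
  wlog huv : u ≤ v generalizing u v
  · exact (this hv hu h.symm (le_of_not_ge huv)).symm
  refine hω.eq_of_volume_eq_zero hy hu hv huv ?_
  have h' := hω.truncA_sub y huv
  rw [h, sub_self] at h'
  exact (measureReal_eq_zero_iff
    (measure_ne_top_of_subset inter_subset_right (by simp))).1 h'.symm

theorem eq_triv_of_sigmaTraj_lt (hω : IsSnakeTraj 0 ω) {s : ℝ} (hs : sigmaTraj ω < s) :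
    ω s = FinPath.triv 0 := by
  by_contra h
  refine absurd (le_csSup ?_ ?_) (not_le.2 hs)
  · rw [hω.apply_zero]
    exact hω.finite
  · simpa [hω.apply_zero] using h

theorem sigmaTraj_nonneg (hω : IsSnakeTraj 0 ω) : 0 ≤ sigmaTraj ω := by
  refine Real.sSup_nonneg fun s hs => ?_
  by_contra! h
  exact hs (by rw [hω.init s h.le, hω.apply_zero])

theorem exists_truncA_gt (hω : IsSnakeTraj 0 ω) (y s : ℝ) : {r | truncA y ω r > s}.Nonempty := by
  have hle : sigmaTraj ω ≤ sigmaTraj ω + |s - truncA y ω (sigmaTraj ω)| + 1 := by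
    linarith [abs_nonneg (s - truncA y ω (sigmaTraj ω))]
  refine ⟨sigmaTraj ω + |s - truncA y ω (sigmaTraj ω)| + 1, ?_⟩
  have h := hω.truncA_sub y hle
  rw [inter_eq_right.2 fun r hr => mem_keepSet_of_eq_triv (hω.eq_triv_of_sigmaTraj_lt hr.1),
    Real.volume_real_Ioc_of_le hle] at h
  simp only [mem_ofPred_eq]
  linarith [le_abs_self (s - truncA y ω (sigmaTraj ω))]

theorem pos_of_truncA_gt (hω : IsSnakeTraj 0 ω) {y s r : ℝ} (hs : 0 ≤ s)
    (hr : truncA y ω r > s) : 0 < r := by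
  by_contra! h
  have := hω.monotone_truncA y h
  rw [truncA_zero] at this
  linarith

theorem bddBelow_truncA_gt (hω : IsSnakeTraj 0 ω) (y : ℝ) {s : ℝ} (hs : 0 ≤ s) :
    BddBelow {r | truncA y ω r > s} :=
  ⟨0, fun _ hr => (hω.pos_of_truncA_gt hs hr).le⟩

theorem truncEta_nonneg (hω : IsSnakeTraj 0 ω) (y : ℝ) {s : ℝ} (hs : 0 ≤ s) :
    0 ≤ truncEta y ω s :=
  Real.sInf_nonneg fun _ hr => (hω.pos_of_truncA_gt hs hr).le

theorem truncA_truncEta (hω : IsSnakeTraj 0 ω) (y : ℝ) {s : ℝ} (hs : 0 ≤ s) :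
    truncA y ω (truncEta y ω s) = s :=
  csInf_superlevel (hω.continuous_truncA y) (hω.exists_truncA_gt y s) (hω.bddBelow_truncA_gt y hs)

theorem truncEta_mem_keepSet (hω : IsSnakeTraj 0 ω) (y : ℝ) {s : ℝ} (hs : 0 ≤ s) :
    truncEta y ω s ∈ keepSet y ω := by
  by_contra h
  obtain ⟨q, hq, hsub⟩ := exists_Ico_subset_of_mem_nhds
    ((hω.isClosed_keepSet y).isOpen_compl.mem_nhds h) (exists_gt _)
  obtain ⟨m, hm, hmq⟩ := exists_between hq
  obtain ⟨r, hr, hrm⟩ := (csInf_lt_iff (hω.bddBelow_truncA_gt y hs) (hω.exists_truncA_gt y s)).1 hm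
  have hA := hω.truncA_sub y hm.le
  have hempty : keepSet y ω ∩ Ioc (truncEta y ω s) m = ∅ := by
    refine eq_empty_of_forall_notMem ?_
    rintro x ⟨hxk, hx⟩
    exact hsub ⟨hx.1.le, hx.2.trans_lt hmq⟩ hxk
  rw [hempty, measureReal_empty, hω.truncA_truncEta y hs] at hA
  have := hω.monotone_truncA y hrm.le
  simp only [mem_ofPred_eq] at hr
  linarith

theorem trunc_zero (hω : IsSnakeTraj 0 ω) {y : ℝ} (hy : y < 0) :
    trunc y ω 0 = FinPath.triv 0 := by
  rw [trunc, max_self, ← hω.apply_zero]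
  refine hω.eq_of_truncA_eq hy (hω.truncEta_mem_keepSet y le_rfl)
    (mem_keepSet_of_eq_triv hω.apply_zero) ?_
  rw [hω.truncA_truncEta y le_rfl, truncA_zero]

theorem eventually_mem_keepSet (hω : IsSnakeTraj 0 ω) {y : ℝ} (hy : y < 0) :
    ∀ᶠ r in 𝓝 (sigmaTraj ω), r ∈ keepSet y ω := by
  obtain ⟨δ, hδ, hball⟩ := hω.cont (sigmaTraj ω) (-y / 2) (by linarith)
  filter_upwards [Metric.ball_mem_nhds _ hδ] with r hr
  rw [mem_keepSet_iff]
  intro t _ _ hty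
  have h1 := (FinPath.abs_toFun_sub_le _ _ t).trans_lt (hball r hr)
  have h2 := (FinPath.abs_toFun_sub_le _ _ t).trans_lt
    (hball (sigmaTraj ω + δ / 2) (by rw [add_sub_cancel_left, abs_of_pos] <;> linarith))
  rw [hω.eq_triv_of_sigmaTraj_lt (by linarith : sigmaTraj ω < sigmaTraj ω + δ / 2)] at h2
  simp only [FinPath.triv] at h2
  rw [hty] at h1
  rw [abs_lt] at h1 h2
  linarith [h1.1, h2.2]

theorem sigmaTraj_trunc (hω : IsSnakeTraj 0 ω) {y : ℝ} (hy : y < 0) :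
    sigmaTraj (trunc y ω) = truncA y ω (sigmaTraj ω) := by
  rcases {s | ω s ≠ ω 0}.eq_empty_or_nonempty with hemp | hne
  · have hall : ∀ s, ω s = ω 0 := fun s => by
      by_contra h
      exact (hemp ▸ h : s ∈ (∅ : Set ℝ))
    have h0 : sigmaTraj ω = 0 := by rw [sigmaTraj, hemp, Real.sSup_empty]
    rw [h0, truncA_zero, sigmaTraj]
    simp [trunc, hall]
  have hbdd : BddAbove {s | ω s ≠ ω 0} := by
    rw [hω.apply_zero]
    exact hω.finite
  have hle : ∀ s ∈ {s | trunc y ω s ≠ trunc y ω 0}, s ≤ truncA y ω (sigmaTraj ω) := by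
    intro s hs
    by_contra! hlt
    have hs0 : 0 ≤ s := by
      have := hω.monotone_truncA y hω.sigmaTraj_nonneg
      rw [truncA_zero] at this
      linarith
    refine hs ?_
    rw [hω.trunc_zero hy, trunc, max_eq_left hs0]
    refine hω.eq_triv_of_sigmaTraj_lt ?_
    by_contra! hσ
    have := hω.monotone_truncA y hσ
    rw [hω.truncA_truncEta y hs0] at this
    linarith
  have hgt : ∀ c < truncA y ω (sigmaTraj ω), ∃ s ∈ {s | trunc y ω s ≠ trunc y ω 0}, c < s := by
    intro c hc
    have hev := (hω.eventually_mem_keepSet hy).and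
      ((hω.continuous_truncA y).continuousAt.eventually (lt_mem_nhds hc))
    obtain ⟨l, hl, hsub⟩ := exists_Ioc_subset_of_mem_nhds hev (exists_lt _)
    obtain ⟨r, hr, hlr⟩ := exists_lt_of_lt_csSup hne hl
    obtain ⟨hrk, hcr⟩ := hsub ⟨hlr, le_csSup hbdd hr⟩
    have hr0 : 0 ≤ r := by
      by_contra! h
      exact hr (by rw [hω.init r h.le, hω.apply_zero])
    have hA0 : 0 ≤ truncA y ω r := truncA_zero (ω := ω) y ▸ hω.monotone_truncA y hr0
    refine ⟨truncA y ω r, ?_, hcr⟩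
    rw [mem_ofPred_eq, hω.trunc_zero hy, ← hω.apply_zero, trunc, max_eq_left hA0,
      hω.eq_of_truncA_eq hy (hω.truncEta_mem_keepSet y hA0) hrk (hω.truncA_truncEta y hA0)]
    exact hr
  obtain ⟨s, hs, -⟩ := hgt _ (sub_one_lt _)
  exact csSup_eq_of_forall_le_of_forall_lt_exists_gt ⟨s, hs⟩ hle hgt

theorem keepSet_mono (hω : IsSnakeTraj 0 ω) {y z : ℝ} (hyz : y ≤ z) (hz : z < 0) :
    keepSet z ω ⊆ keepSet y ω := by
  intro r hr
  rw [mem_keepSet_iff] at hr ⊢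
  intro t ht htl hty
  obtain ⟨t', ht', htt, hty'⟩ := FinPath.exists_hit (hω.start r) ht.le hz (hty.trans_le hyz)
  exact hr t' ht' (htt.trans_lt htl) hty'

theorem keepSet_sdiff_subset (hω : IsSnakeTraj 0 ω) (y z : ℝ) :
    keepSet y ω \ keepSet z ω ⊆ Icc 0 (sigmaTraj ω) := by
  rintro r ⟨-, hr⟩
  constructor
  · by_contra! h
    exact hr (mem_keepSet_of_eq_triv (hω.init r h.le))
  · by_contra! h
    exact hr (mem_keepSet_of_eq_triv (hω.eq_triv_of_sigmaTraj_lt h))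

theorem abs_truncA_sub_le (hω : IsSnakeTraj 0 ω) {y z : ℝ} (hyz : y ≤ z) (hz : z < 0) {r : ℝ}
    (hr : 0 ≤ r) :
    |truncA z ω r - truncA y ω r| ≤ volume.real (keepSet y ω \ keepSet z ω) := by
  have hy' := hω.truncA_sub y hr
  have hz' := hω.truncA_sub z hr
  rw [truncA_zero, sub_zero] at hy' hz'
  rw [hy', hz', abs_sub_comm, abs_of_nonneg, sub_le_iff_le_add, add_comm]
  · refine (measureReal_mono (s₂ := keepSet z ω ∩ Ioc 0 r ∪ keepSet y ω \ keepSet z ω) ?_ ?_).trans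
      (measureReal_union_le _ _)
    · rintro x ⟨hx, hx'⟩
      by_cases h : x ∈ keepSet z ω
      · exact Or.inl ⟨h, hx'⟩
      · exact Or.inr ⟨hx, h⟩
    · exact (measure_union_lt_top
        (measure_lt_top_of_subset inter_subset_right (by simp))
        (measure_lt_top_of_subset (hω.keepSet_sdiff_subset y z) (by simp))).ne
  · exact sub_nonneg.2 (measureReal_mono (inter_subset_inter_left _ (hω.keepSet_mono hyz hz))
      (measure_ne_top_of_subset inter_subset_right (by simp)))

theorem exists_modulus (hω : IsSnakeTraj 0 ω) {y : ℝ} (hy : y < 0) {δ : ℝ} (hδ : 0 < δ) :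
    ∃ ε > 0, ∀ u ∈ keepSet y ω, ∀ v ∈ keepSet y ω, 0 ≤ u → 0 ≤ v →
      |truncA y ω u - truncA y ω v| < ε → FinPath.dW (ω u) (ω v) < δ := by
  set T := sigmaTraj ω + 1 with hT
  have hT0 : 0 ≤ T := by linarith [hω.sigmaTraj_nonneg]
  have htriv : ∀ s, T ≤ s → ω s = FinPath.triv 0 := fun s hs =>
    hω.eq_triv_of_sigmaTraj_lt (by linarith)
  have hclamp : ∀ s, ω (min s T) = ω s := fun s => by
    rcases le_total s T with h | h
    · rw [min_eq_left h]
    · rw [min_eq_right h, htriv T le_rfl, htriv s h]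
  have hclampk : ∀ s ∈ keepSet y ω, min s T ∈ keepSet y ω := fun s hs => by
    rw [mem_keepSet_iff, hclamp s]
    exact mem_keepSet_iff.1 hs
  let I := keepSet y ω ∩ Icc 0 T
  have hI : IsCompact I := isCompact_Icc.inter_left (hω.isClosed_keepSet y)
  let C := (I ×ˢ I) ∩ {p : ℝ × ℝ | δ ≤ dist (ω p.1) (ω p.2)}
  have hC : IsCompact C := (hI.prod hI).inter_right (isClosed_le continuous_const
    ((hω.continuous.comp continuous_fst).dist (hω.continuous.comp continuous_snd)))
  have hcont : Continuous fun p : ℝ × ℝ => |truncA y ω p.1 - truncA y ω p.2| :=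
    (((hω.continuous_truncA y).comp continuous_fst).sub
      ((hω.continuous_truncA y).comp continuous_snd)).abs
  have hkey : ∃ ε > 0, ∀ p ∈ C, ε ≤ |truncA y ω p.1 - truncA y ω p.2| := by
    rcases C.eq_empty_or_nonempty with h | h
    · exact ⟨1, one_pos, by simp [h]⟩
    · obtain ⟨p, hp, hmin⟩ := hC.exists_isMinOn h hcont.continuousOn
      refine ⟨_, abs_pos.2 fun h0 => ?_, fun q hq => hmin hq⟩
      have heq := hω.eq_of_truncA_eq hy hp.1.1.1 hp.1.2.1 (sub_eq_zero.1 h0)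
      have hd : δ ≤ dist (ω p.1) (ω p.2) := hp.2
      rw [heq, dist_self] at hd
      linarith
  obtain ⟨ε, hε, hle⟩ := hkey
  refine ⟨ε, hε, fun u hu v hv hu0 hv0 huv => ?_⟩
  by_contra! hge
  have hmem : (min u T, min v T) ∈ C := by
    refine ⟨⟨⟨hclampk u hu, le_min hu0 hT0, min_le_right _ _⟩,
      ⟨hclampk v hv, le_min hv0 hT0, min_le_right _ _⟩⟩, ?_⟩
    simp only [mem_ofPred_eq, hclamp]
    exact hge
  have h1 := hle _ hmem
  simp only [(hω.monotone_truncA y).map_min] at h1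
  have h2 := abs_min_sub_min_le_max (truncA y ω u) (truncA y ω T) (truncA y ω v) (truncA y ω T)
  rw [sub_self, abs_zero, max_eq_left (abs_nonneg _)] at h2
  linarith

theorem tau_eq_lifetime (hω : IsSnakeTraj 0 ω) {y : ℝ} (hy : y < 0) {z : ℕ → ℝ}
    (hz : Tendsto z atTop (𝓝 y)) {r : ℝ} (hr : r ∈ keepSet y ω)
    (hr' : ∀ n, r ∉ keepSet (z n) ω) : FinPath.tau y (ω r) = ((ω r).lifetime : EReal) := by
  have hhit : ∃ t, 0 < t ∧ t ≤ (ω r).lifetime ∧ (ω r).toFun t = y := by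
    by_contra! h
    obtain ⟨c, hc, hle⟩ := FinPath.exists_margin (hω.start r) hy h
    obtain ⟨n, hn⟩ := (hz.eventually_lt_const hc).exists
    refine hr' n (mem_keepSet_iff.2 fun t _ _ hty => ?_)
    linarith [hle t]
  have hge : ∀ t, 0 < t → (ω r).toFun t = y → (ω r).lifetime ≤ t := fun t ht hty => by
    by_contra! h
    exact mem_keepSet_iff.1 hr t ht h hty
  obtain ⟨t, ht, htl, hty⟩ := hhit
  refine le_antisymm ?_ (le_sInf ?_)
  · refine sInf_le ⟨t, ⟨ht.le, htl, hty⟩, ?_⟩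
    simp only [le_antisymm htl (hge t ht hty)]
  · rintro _ ⟨q, ⟨hq, -, hqy⟩, rfl⟩
    refine EReal.coe_le_coe_iff.2 (hge q (hq.lt_of_ne ?_) hqy)
    rintro rfl
    exact hy.ne (hqy.symm.trans (hω.start r))

theorem tendsto_volume_sdiff (hω : IsSnakeTraj 0 ω) {y : ℝ} (hy : y < 0)
    (hnull : volume {s : ℝ | s ∈ Icc 0 (sigmaTraj ω) ∧
      FinPath.tau y (ω s) = ((ω s).lifetime : EReal)} = 0)
    {z : ℕ → ℝ} (hz0 : ∀ n, z n < 0) (hanti : Antitone z) (hz : Tendsto z atTop (𝓝 y)) :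
    Tendsto (fun n => volume.real (keepSet y ω \ keepSet (z n) ω)) atTop (𝓝 0) := by
  have hlim := tendsto_measure_iInter_atTop (μ := volume)
    (s := fun n => keepSet y ω \ keepSet (z n) ω)
    (fun n => ((hω.isClosed_keepSet y).measurableSet.diff
      (hω.isClosed_keepSet (z n)).measurableSet).nullMeasurableSet)
    (fun m n hmn => sdiff_subset_sdiff_right (hω.keepSet_mono (hanti hmn) (hz0 m)))
    ⟨0, measure_ne_top_of_subset (hω.keepSet_sdiff_subset y (z 0)) (by simp)⟩
  rw [measure_mono_null ?_ hnull] at hlim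
  · exact (ENNReal.tendsto_toReal ENNReal.zero_ne_top).comp hlim
  · intro r hr
    rw [mem_iInter] at hr
    exact ⟨hω.keepSet_sdiff_subset y (z 0) (hr 0),
      hω.tau_eq_lifetime hy hz (hr 0).1 fun n => (hr n).2⟩

end IsSnakeTraj

/-- **Continuity of truncations in the level** (Lemma 2.3 of the paper).
Let `ω` be a snake trajectory with initial point `0` and `b < 0` such that
the set `{s ∈ [0, σ(ω)] : τ_b(ω_s) = ζ_s(ω)}` has zero Lebesgue measure. Then for
any sequence `(bₙ)` with `b < bₙ < 0` decreasing to `b`, `tr_{bₙ}(ω) → tr_b(ω)`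
in `(S, d_S)`. -/
theorem trunc_tendsto_of_null
    (ω : ℝ → FinPath) (hω : IsSnakeTraj 0 ω) (b : ℝ) (hb : b < 0)
    (hnull : volume {s : ℝ | s ∈ Set.Icc 0 (sigmaTraj ω) ∧
      FinPath.tau b (ω s) = ((ω s).lifetime : EReal)} = 0)
    (bseq : ℕ → ℝ) (hrange : ∀ n, b < bseq n ∧ bseq n < 0)
    (hanti : Antitone bseq) (hlim : Filter.Tendsto bseq Filter.atTop (nhds b)) :
    Filter.Tendsto (fun n => dS (trunc (bseq n) ω) (trunc b ω))
      Filter.atTop (nhds 0) := by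
  have hsmall := hω.tendsto_volume_sdiff hb hnull (fun n => (hrange n).2) hanti hlim
  rw [← add_zero (0 : ℝ)]
  refine Tendsto.add ?_ ?_
  · refine squeeze_zero (fun n => abs_nonneg _) (fun n => ?_) hsmall
    rw [hω.sigmaTraj_trunc hb, hω.sigmaTraj_trunc (hrange n).2]
    exact hω.abs_truncA_sub_le (hrange n).1.le (hrange n).2 hω.sigmaTraj_nonneg
  · refine Metric.tendsto_nhds.2 fun δ hδ => ?_
    obtain ⟨ε, hε, hmod⟩ := hω.exists_modulus hb (half_pos hδ)
    filter_upwards [hsmall.eventually_lt_const hε] with n hn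
    have hle : (⨆ s, FinPath.dW (trunc (bseq n) ω s) (trunc b ω s)) ≤ δ / 2 := by
      refine ciSup_le fun s => ?_
      have hs : 0 ≤ max s 0 := le_max_right _ _
      have hη := hω.truncEta_nonneg (bseq n) hs
      refine (hmod _ (hω.keepSet_mono (hrange n).1.le (hrange n).2
        (hω.truncEta_mem_keepSet (bseq n) hs)) _ (hω.truncEta_mem_keepSet b hs) hη
        (hω.truncEta_nonneg b hs) ?_).le
      have h := hω.abs_truncA_sub_le (hrange n).1.le (hrange n).2 hη
      rw [hω.truncA_truncEta (bseq n) hs, abs_sub_comm] at h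
      rw [hω.truncA_truncEta b hs]
      exact h.trans_lt hn
    rw [Real.dist_eq, sub_zero, abs_of_nonneg (Real.iSup_nonneg fun s => FinPath.dW_nonneg _ _)]
    linarith
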